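/- Let H be a real Hilbert space, k ≥ 1 and m ≥ 1 integers, and let M be an m-dimensional C^k-submanifold of H that is closed and connected as a subset of H. Let L ⊆ H be a linear subspace with dim L = m such that L ⊆ T_h M for all h ∈ M. Then M is an affine space generated by L, i.e. there exists g₀ ∈ L^⊥ with M = {g₀} + L. -/

import Mathlib

open Set Pointwise

noncomputable section

/-- `φ : V → U ∩ M` is a parametrization of class `C^k` of `M` around `h₀`:
`U` is an open neighborhood of `h₀`, `V` is open, `φ ∈ C^k(V;H)`,
`φ : V → U ∩ M` is a homeomorphism, and `Dφ(y)` is injective for all `y ∈ V`. -/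
structure IsParametrization {E H : Type*} [NormedAddCommGroup E] [NormedSpace ℝ E]
    [NormedAddCommGroup H] [NormedSpace ℝ H] (k : ℕ) (M : Set H) (h₀ : H)
    (V : Set E) (φ : E → H) (U : Set H) : Prop where
  isOpen_U : IsOpen U
  h₀_mem_U : h₀ ∈ U
  isOpen_V : IsOpen V
  contDiffOn : ContDiffOn ℝ k φ V
  image_eq : φ '' V = U ∩ M
  injOn : Set.InjOn φ V
  exists_contInv : ∃ ψ : H → E, ContinuousOn ψ (U ∩ M) ∧ ∀ y ∈ V, ψ (φ y) = y
  fderiv_injective : ∀ y ∈ V, Function.Injective (fderiv ℝ φ y)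

/-- `M` is an `m`-dimensional `C^k`-submanifold of `H`: `M` is nonempty and every
point of `M` admits a parametrization with domain an open subset of `ℝ^m`. -/
def IsSubmanifold {H : Type*} [NormedAddCommGroup H] [NormedSpace ℝ H]
    (k m : ℕ) (M : Set H) : Prop :=
  M.Nonempty ∧ ∀ h₀ ∈ M, ∃ (V : Set (EuclideanSpace ℝ (Fin m)))
    (φ : EuclideanSpace ℝ (Fin m) → H) (U : Set H), IsParametrization k M h₀ V φ U

/-- The tangent space `T_h M`: the image of `Dφ(φ⁻¹(h))` for a parametrization `φ`
of `M` around `h`. -/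
def TangentSet {H : Type*} [NormedAddCommGroup H] [NormedSpace ℝ H]
    (k m : ℕ) (M : Set H) (h : H) : Set H :=
  {v | ∃ (V : Set (EuclideanSpace ℝ (Fin m))) (φ : EuclideanSpace ℝ (Fin m) → H)
    (U : Set H), IsParametrization k M h V φ U ∧
      ∃ y ∈ V, φ y = h ∧ v ∈ Set.range (fderiv ℝ φ y)}

/-- `M` has flatness at least `d` at `h₀`: some `d`-dimensional subspace `L ⊆ H` is
contained in all tangent spaces `T_h M` for `h ∈ U ∩ M`, `U` an open neighborhood of `h₀`. -/
def FlatAt {H : Type*} [NormedAddCommGroup H] [NormedSpace ℝ H]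
    (k m : ℕ) (M : Set H) (h₀ : H) (d : ℕ) : Prop :=
  ∃ (L : Submodule ℝ H) (U : Set H), Module.finrank ℝ L = d ∧ IsOpen U ∧ h₀ ∈ U ∧
    ∀ h ∈ U ∩ M, (L : Set H) ⊆ TangentSet k m M h

/-- The flatness `fl M(h₀)` of `M` at `h₀`: the largest `d ∈ {0,…,m}` such that `M` has
flatness at least `d` at `h₀`. -/
def flatnessAt {H : Type*} [NormedAddCommGroup H] [NormedSpace ℝ H]
    (k m : ℕ) (M : Set H) (h₀ : H) : ℕ :=
  sSup {d | d ≤ m ∧ FlatAt k m M h₀ d}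

/-- The flatness `fl M` of `M`: the minimum of `fl M(h)` over `h ∈ M`. -/
def flatness {H : Type*} [NormedAddCommGroup H] [NormedSpace ℝ H]
    (k m : ℕ) (M : Set H) : ℕ :=
  sInf (flatnessAt k m M '' M)

open Filter Topology

lemma ContinuousLinearMap.exists_comp_eq_id_of_injective {E H : Type*} [NormedAddCommGroup E]
    [NormedSpace ℝ E] [FiniteDimensional ℝ E] [NormedAddCommGroup H] [NormedSpace ℝ H]
    (A : E →L[ℝ] H) (hA : Function.Injective A) :
    ∃ p : H →L[ℝ] E, p.comp A = ContinuousLinearMap.id ℝ E := by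
  obtain ⟨q, hq⟩ := Submodule.ClosedComplemented.of_finiteDimensional A.range
  let e := (LinearEquiv.ofInjective (A : E →ₗ[ℝ] H) hA).toContinuousLinearEquiv
  refine ⟨(e.symm : _ →L[ℝ] E).comp q, ?_⟩
  ext x
  have : q (A x) = e x := hq (e x)
  simp [this]

namespace IsParametrization

variable {E H : Type*} [NormedAddCommGroup E] [NormedSpace ℝ E]
  [NormedAddCommGroup H] [NormedSpace ℝ H] {k : ℕ} {M : Set H} {h₀ : H}
  {V : Set E} {φ : E → H} {U : Set H}

lemma hasStrictFDerivAt (hφ : IsParametrization k M h₀ V φ U) (hk : 1 ≤ k) {y : E} (hy : y ∈ V) :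
    HasStrictFDerivAt φ (fderiv ℝ φ y) y :=
  (hφ.contDiffOn.contDiffAt (hφ.isOpen_V.mem_nhds hy)).hasStrictFDerivAt
    (by exact_mod_cast (by omega : k ≠ 0))

lemma apply_mem (hφ : IsParametrization k M h₀ V φ U) {y : E} (hy : y ∈ V) : φ y ∈ U ∩ M :=
  hφ.image_eq ▸ mem_image_of_mem φ hy

/-- The inverse chart turns any map into `M` converging to `φ y` into a lift converging to `y`. -/
lemma exists_lift {α : Type*} {l : Filter α} (hφ : IsParametrization k M h₀ V φ U) {y : E}
    (hy : y ∈ V) {c : α → H} (hc : Tendsto c l (𝓝 (φ y))) (hcM : ∀ᶠ t in l, c t ∈ M) :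
    ∃ z : α → E, Tendsto z l (𝓝 y) ∧ ∀ᶠ t in l, z t ∈ V ∧ φ (z t) = c t := by
  obtain ⟨ψ, hψ, hinv⟩ := hφ.exists_contInv
  have hcU : ∀ᶠ t in l, c t ∈ U ∩ M :=
    (hc.eventually (hφ.isOpen_U.mem_nhds (hφ.apply_mem hy).1)).and hcM
  refine ⟨fun t => ψ (c t), ?_, ?_⟩
  · have := (hψ (φ y) (hφ.apply_mem hy)).tendsto
    rw [hinv y hy] at this
    exact this.comp (tendsto_nhdsWithin_iff.2 ⟨hc, hcU⟩)
  · filter_upwards [hcU] with t ht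
    rw [← hφ.image_eq] at ht
    obtain ⟨w, hw, hwt⟩ := ht
    simp only [← hwt, hinv w hw, hw, and_self]

/-- The velocity of a curve in `M` lies in the image of the derivative of a parametrization. -/
lemma mem_range_of_hasDerivAt [FiniteDimensional ℝ E] (hφ : IsParametrization k M h₀ V φ U)
    (hk : 1 ≤ k) {y : E} (hy : y ∈ V) {c : ℝ → H} {v : H} {t₀ : ℝ} (hc : HasDerivAt c v t₀)
    (hc₀ : c t₀ = φ y) (hcM : ∀ᶠ t in 𝓝 t₀, c t ∈ M) : v ∈ range (fderiv ℝ φ y) := by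
  have : CompleteSpace E := FiniteDimensional.complete ℝ E
  obtain ⟨p, hp⟩ := (fderiv ℝ φ y).exists_comp_eq_id_of_injective (hφ.fderiv_injective y hy)
  have hf : HasStrictFDerivAt (p ∘ φ) ((ContinuousLinearEquiv.refl ℝ E : E ≃L[ℝ] E) : E →L[ℝ] E)
      y := by
    have := p.hasStrictFDerivAt.comp y (hφ.hasStrictFDerivAt hk hy)
    rwa [hp] at this
  obtain ⟨z, hz, hzc⟩ := hφ.exists_lift hy (hc₀ ▸ hc.continuousAt.tendsto) hcM
  have hzloc : z =ᶠ[𝓝 t₀] fun t => hf.localInverse _ _ _ (p (c t)) := by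
    filter_upwards [hz.eventually hf.eventually_left_inverse, hzc] with t ht htc
    rw [← htc.2]
    exact ht.symm
  have hpc : HasDerivAt (fun t => p (c t)) (p v) t₀ := p.hasFDerivAt.comp_hasDerivAt t₀ hc
  have hzd : HasDerivAt z (p v) t₀ := by
    refine HasDerivAt.congr_of_eventuallyEq ?_ hzloc
    have hg := hf.to_localInverse.hasFDerivAt
    have he : (p ∘ φ) y = p (c t₀) := by simp [hc₀]
    rw [he] at hg
    exact hg.comp_hasDerivAt t₀ hpc
  have hz₀ : z t₀ = y := tendsto_nhds_unique hzd.continuousAt.tendsto hz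
  have hφz : HasDerivAt (fun t => φ (z t)) (fderiv ℝ φ y (p v)) t₀ := by
    have := (hφ.hasStrictFDerivAt hk hy).hasFDerivAt
    rw [← hz₀] at this
    have := this.comp_hasDerivAt t₀ hzd
    rwa [hz₀] at this
  exact ⟨p v, hφz.unique (hc.congr_of_eventuallyEq (hzc.mono fun t ht => ht.2))⟩

end IsParametrization

section Tangent

variable {H : Type*} [NormedAddCommGroup H] [NormedSpace ℝ H] {k m : ℕ} {M : Set H} {h₀ : H}
  {V : Set (EuclideanSpace ℝ (Fin m))} {φ : EuclideanSpace ℝ (Fin m) → H} {U : Set H}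

lemma IsParametrization.tangentSet_subset_range (hφ : IsParametrization k M h₀ V φ U) (hk : 1 ≤ k)
    {y : EuclideanSpace ℝ (Fin m)} (hy : y ∈ V) :
    TangentSet k m M (φ y) ⊆ range (fderiv ℝ φ y) := by
  rintro v ⟨V', φ', U', hφ', y', hy', hyy', w, rfl⟩
  have hline : HasDerivAt (fun t : ℝ => y' + t • w) w 0 := by
    simpa using ((hasDerivAt_id (0 : ℝ)).smul_const w).const_add y'
  have hd : HasDerivAt (fun t : ℝ => φ' (y' + t • w)) (fderiv ℝ φ' y' w) 0 := by
    refine HasFDerivAt.comp_hasDerivAt (0 : ℝ) ?_ hline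
    simpa using (hφ'.hasStrictFDerivAt hk hy').hasFDerivAt
  refine hφ.mem_range_of_hasDerivAt hk hy hd (by simpa using hyy') ?_
  have hV' : ∀ᶠ t in 𝓝 (0 : ℝ), y' + t • w ∈ V' :=
    hline.continuousAt.eventually (hφ'.isOpen_V.mem_nhds (by simpa using hy'))
  exact hV'.mono fun t ht => (hφ'.apply_mem ht).2

lemma IsParametrization.range_fderiv_eq (hφ : IsParametrization k M h₀ V φ U) (hk : 1 ≤ k)
    {L : Submodule ℝ H} (hdim : Module.finrank ℝ L = m)
    (htang : ∀ h ∈ M, (L : Set H) ⊆ TangentSet k m M h)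
    {y : EuclideanSpace ℝ (Fin m)} (hy : y ∈ V) :
    (fderiv ℝ φ y).range = L := by
  symm
  apply Submodule.eq_of_le_of_finrank_eq
  · exact fun v hv => hφ.tangentSet_subset_range hk hy (htang _ (hφ.apply_mem hy).2 hv)
  · rw [hdim, LinearMap.finrank_range_of_inj (hφ.fderiv_injective y hy)]
    simp

end Tangent

section Flat

variable {H : Type*} [NormedAddCommGroup H] [InnerProductSpace ℝ H] {k m : ℕ} {M : Set H}
  {L : Submodule ℝ H} [FiniteDimensional ℝ L]

lemma IsSubmanifold.eventually_starProjection_orthogonal_eq (hM : IsSubmanifold k m M)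
    (hk : 1 ≤ k) (hdim : Module.finrank ℝ L = m)
    (htang : ∀ h ∈ M, (L : Set H) ⊆ TangentSet k m M h) {h : H} (hh : h ∈ M) :
    ∀ᶠ x in 𝓝[M] h, Lᗮ.starProjection x = Lᗮ.starProjection h := by
  obtain ⟨V, φ, U, hφ⟩ := hM.2 h hh
  obtain ⟨y, hy, rfl⟩ : h ∈ φ '' V := hφ.image_eq ▸ ⟨hφ.h₀_mem_U, hh⟩
  obtain ⟨r, hr, hball⟩ := Metric.isOpen_iff.1 hφ.isOpen_V y hy
  have hd : ∀ w ∈ V, HasFDerivAt (fun w => Lᗮ.starProjection (φ w))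
      (0 : EuclideanSpace ℝ (Fin m) →L[ℝ] H) w := by
    intro w hw
    have hzero : (Lᗮ.starProjection).comp (fderiv ℝ φ w) = 0 := by
      ext u
      have hu : fderiv ℝ φ w u ∈ L := by
        rw [← hφ.range_fderiv_eq hk hdim htang hw]
        exact ⟨u, rfl⟩
      exact Submodule.starProjection_orthogonal_apply_eq_zero hu
    rw [← hzero]
    exact (Lᗮ.starProjection).hasFDerivAt.comp w (hφ.hasStrictFDerivAt hk hw).hasFDerivAt
  obtain ⟨z, hz, hzφ⟩ := hφ.exists_lift hy (c := id) (tendsto_id.mono_left nhdsWithin_le_nhds)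
    (eventually_mem_nhdsWithin (a := φ y) (s := M))
  filter_upwards [hz.eventually (Metric.ball_mem_nhds y hr), hzφ] with x hx hxφ
  have hconst := Metric.isOpen_ball.is_const_of_fderiv_eq_zero
    (convex_ball y r).isPreconnected
    (fun w hw => (hd w (hball hw)).differentiableAt.differentiableWithinAt)
    (fun w hw => (hd w (hball hw)).fderiv) hx (Metric.mem_ball_self hr)
  rwa [hxφ.2] at hconst

lemma IsSubmanifold.starProjection_orthogonal_eq (hM : IsSubmanifold k m M)
    (hk : 1 ≤ k) (hconn : IsPreconnected M) (hdim : Module.finrank ℝ L = m)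
    (htang : ∀ h ∈ M, (L : Set H) ⊆ TangentSet k m M h) {x h : H} (hx : x ∈ M) (hh : h ∈ M) :
    Lᗮ.starProjection x = Lᗮ.starProjection h := by
  have : PreconnectedSpace M := isPreconnected_iff_preconnectedSpace.1 hconn
  have hloc : IsLocallyConstant fun z : M => Lᗮ.starProjection (z : H) := by
    refine (IsLocallyConstant.iff_eventually_eq _).2 fun z => ?_
    have := hM.eventually_starProjection_orthogonal_eq hk hdim htang z.2
    rwa [nhdsWithin_eq_map_subtype_coe z.2, eventually_map] at this
  exact hloc.apply_eq_of_preconnectedSpace ⟨x, hx⟩ ⟨h, hh⟩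

lemma IsSubmanifold.isOpen_translate (hM : IsSubmanifold k m M)
    (hk : 1 ≤ k) (hdim : Module.finrank ℝ L = m)
    (htang : ∀ h ∈ M, (L : Set H) ⊆ TangentSet k m M h) {g₀ : H}
    (hg₀ : ∀ x ∈ M, Lᗮ.starProjection x = g₀) :
    IsOpen {l : L | g₀ + l ∈ M} := by
  have hsplit : ∀ x ∈ M, g₀ + L.orthogonalProjectionOnto x = x := fun x hx => by
    rw [← hg₀ x hx, add_comm, ← Submodule.starProjection_apply]
    exact L.starProjection_add_starProjection_orthogonal x
  refine isOpen_iff_mem_nhds.2 fun l (hl : g₀ + l ∈ M) => ?_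
  obtain ⟨V, φ, U, hφ⟩ := hM.2 _ hl
  obtain ⟨y, hy, hyl⟩ : g₀ + l ∈ φ '' V := hφ.image_eq ▸ ⟨hφ.h₀_mem_U, hl⟩
  have hf := L.orthogonalProjectionOnto.hasStrictFDerivAt.comp y (hφ.hasStrictFDerivAt hk hy)
  have hmap := hf.map_nhds_eq_of_surj (by
    rw [eq_top_iff]
    rintro v -
    have hv : (v : H) ∈ (fderiv ℝ φ y).range := by
      rw [hφ.range_fderiv_eq hk hdim htang hy]
      exact v.2
    obtain ⟨u, hu⟩ := hv
    refine ⟨u, ?_⟩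
    have hu' : fderiv ℝ φ y u = v := hu
    simp [hu'])
  have hfy : L.orthogonalProjectionOnto (φ y) = l := by
    ext
    have := hsplit _ hl
    rw [← hyl] at this
    simpa [hyl] using this.trans hyl
  rw [hfy] at hmap
  rw [← hmap]
  refine mem_of_superset (image_mem_map (hφ.isOpen_V.mem_nhds hy)) ?_
  rintro _ ⟨w, hw, rfl⟩
  have hwM := (hφ.apply_mem hw).2
  rwa [mem_ofPred_eq, hsplit _ hwM]

end Flat

/-- if `M` is closed and connected, `dim L = m` and `L ⊆ T_h M` for all
`h ∈ M`, then `M` is an affine space generated by `L`. -/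
theorem stmt9 {H : Type*} [NormedAddCommGroup H] [InnerProductSpace ℝ H] [CompleteSpace H]
    (k m : ℕ) (hk : 1 ≤ k) (hm : 1 ≤ m) (M : Set H) (hM : IsSubmanifold k m M)
    (hMclosed : IsClosed M) (hconn : IsConnected M)
    (L : Submodule ℝ H) [FiniteDimensional ℝ L] (hdim : Module.finrank ℝ L = m)
    (htang : ∀ h ∈ M, (L : Set H) ⊆ TangentSet k m M h) :
    ∃ g₀ ∈ Lᗮ, M = ({g₀} : Set H) + (L : Set H) := by
  obtain ⟨x₀, hx₀⟩ := hM.1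
  set g₀ := Lᗮ.starProjection x₀
  have hproj : ∀ x ∈ M, Lᗮ.starProjection x = g₀ := fun x hx =>
    hM.starProjection_orthogonal_eq hk hconn.isPreconnected hdim htang hx hx₀
  have hdecomp : ∀ x ∈ M, g₀ + L.starProjection x = x := fun x hx => by
    rw [← hproj x hx, add_comm]
    exact L.starProjection_add_starProjection_orthogonal x
  have huniv : {l : L | g₀ + l ∈ M} = univ := by
    refine IsClopen.eq_univ ⟨hMclosed.preimage (by fun_prop),
      hM.isOpen_translate hk hdim htang hproj⟩ ⟨L.orthogonalProjectionOnto x₀, ?_⟩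
    rw [mem_ofPred_eq, ← Submodule.starProjection_apply, hdecomp x₀ hx₀]
    exact hx₀
  refine ⟨g₀, Submodule.starProjection_apply_mem _ _, ?_⟩
  ext x
  rw [singleton_add, mem_image]
  constructor
  · exact fun hx => ⟨L.starProjection x, Submodule.starProjection_apply_mem _ _, hdecomp x hx⟩
  · rintro ⟨l, hl, rfl⟩
    exact (huniv ▸ mem_univ (⟨l, hl⟩ : L) : (⟨l, hl⟩ : L) ∈ {l : L | g₀ + l ∈ M})
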